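/- There exist a smooth nonnegative function W : ℝ → ℝ supported in [0,1], a real sequence (λₙ) with λₙ → 0 and Σₙ λₙ² = ∞, and a strictly increasing sequence (Nₙ) of positive reals with Nₙ + 1 < Nₙ₊₁ and Nₙ/Nₙ₊₁ → 0, such that the Pearson potential V(x) = Σₙ λₙ W(x − Nₙ) exhibits uniform clock behavior on every compact interval I ⊂ (0,∞) with ρ(ξ) = 1/(2π√ξ): writing u(ξ,·) for the Neumann solution of −∂ₓ²u + V·u = ξ·u and Z_L = {ξ ∈ ℝ : ∂ₓu(ξ,L) = 0}, for each fixed n ∈ ℤ one has L·(ξₙ₊₁ᴸ(ξ*) − ξₙᴸ(ξ*))·ρ(ξ*) → 1 as L → ∞, uniformly in ξ* ∈ I, where the elements of Z_L are enumerated around ξ* as ... < ξ₋₁ᴸ(ξ*) < ξ* ≤ ξ₀ᴸ(ξ*) < ξ₁ᴸ(ξ*) < ... . -/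

import Mathlib

open scoped Real

/-- `x` is the `n`-th point of the set `Z` around the reference point `c`, for the
enumeration `... < ξ₋₁ < c ≤ ξ₀ < ξ₁ < ...`: for `n ≥ 0` there are exactly `n` points of
`Z` in `[c, x)`, and for `n < 0` there are exactly `-n-1` points of `Z` in `(x, c)`. -/
def IsNthPoint (Z : Set ℝ) (c : ℝ) (n : ℤ) (x : ℝ) : Prop :=
  x ∈ Z ∧
    ((0 ≤ n ∧ c ≤ x ∧ (Z ∩ Set.Ico c x).Finite ∧ (Z ∩ Set.Ico c x).ncard = n.toNat) ∨
      (n < 0 ∧ x < c ∧ (Z ∩ Set.Ioo x c).Finite ∧ (Z ∩ Set.Ioo x c).ncard = (-n - 1).toNat))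

open Set Filter Topology

section PruferAngle

/-- A nontrivial solution of `-u'' + V u = k² u` on the half-line has `u² + (u'/k)² > 0`. -/
theorem sq_add_sq_pos_of_schrodinger {V u v : ℝ → ℝ} {k M : ℝ} (hk : 0 < k)
    (hM : ∀ x, |V x| ≤ M)
    (hu : ∀ x ∈ Ici (0 : ℝ), HasDerivWithinAt u (v x) (Ici 0) x)
    (hv : ∀ x ∈ Ici (0 : ℝ), HasDerivWithinAt v ((V x - k ^ 2) * u x) (Ici 0) x)
    (hu0 : u 0 ≠ 0) {x : ℝ} (hx : 0 ≤ x) : 0 < u x ^ 2 + (v x / k) ^ 2 := by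
  set E : ℝ → ℝ := fun x => (u x ^ 2 + (v x / k) ^ 2) * Real.exp (M / k * x) with hE
  have hder : ∀ x ∈ Ici (0 : ℝ), HasDerivWithinAt E
      ((2 * (V x / k) * (u x * (v x / k)) + M / k * (u x ^ 2 + (v x / k) ^ 2)) *
        Real.exp (M / k * x)) (Ici 0) x := by
    intro x hx
    have h1 := ((hu x hx).pow 2).add (((hv x hx).div_const k).pow 2)
    have h2 : HasDerivWithinAt (fun x => Real.exp (M / k * x))
        (Real.exp (M / k * x) * (M / k * 1)) (Ici 0) x :=
      (((hasDerivAt_id x).const_mul (M / k)).exp).hasDerivWithinAt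
    refine (h1.mul h2).congr_deriv ?_
    simp only [Pi.add_apply, Pi.pow_apply, Nat.reduceSub, pow_one, Nat.cast_ofNat]
    field_simp
    ring
  have hmono : MonotoneOn E (Ici 0) := by
    refine monotoneOn_of_hasDerivWithinAt_nonneg (convex_Ici 0)
      (fun x hx => (hder x hx).continuousWithinAt)
      (fun x hx => (hder x (interior_subset hx)).mono interior_subset) fun x _ => ?_
    refine mul_nonneg ?_ (Real.exp_pos _).le
    have h1 : |V x / k| ≤ M / k := by
      rw [abs_div, abs_of_pos hk]; gcongr; exact hM x
    obtain ⟨h2, h3⟩ := abs_le.1 h1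
    nlinarith [mul_nonneg (sub_nonneg.2 h3) (sq_nonneg (u x - v x / k)),
      mul_nonneg (by linarith : 0 ≤ M / k + V x / k) (sq_nonneg (u x + v x / k))]
  have h0 : 0 < E 0 := by
    simp only [hE]
    positivity
  have h := h0.trans_le (hmono self_mem_Ici hx hx)
  exact pos_of_mul_pos_left h (Real.exp_pos _).le

/-- Existence of the Prüfer angle of a Neumann solution. -/
theorem exists_prufer_angle {V u v : ℝ → ℝ} {k M : ℝ} (hk : 0 < k) (hV : Continuous V)
    (hM : ∀ x, |V x| ≤ M)
    (hu : ∀ x ∈ Ici (0 : ℝ), HasDerivWithinAt u (v x) (Ici 0) x)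
    (hv : ∀ x ∈ Ici (0 : ℝ), HasDerivWithinAt v ((V x - k ^ 2) * u x) (Ici 0) x)
    (hu0 : u 0 = 1) (hv0 : v 0 = 0) :
    ∃ θ : ℝ → ℝ, θ 0 = 0 ∧ Continuous θ ∧
      (∀ x, 0 ≤ x → HasDerivAt θ (k - V x * (Real.cos (θ x) ^ 2 / k)) x) ∧
      ∀ x, 0 ≤ x → (v x = 0 ↔ Real.sin (θ x) = 0) := by
  have hr : ∀ {x}, 0 ≤ x → 0 < u x ^ 2 + (v x / k) ^ 2 :=
    sq_add_sq_pos_of_schrodinger hk hM hu hv (by simp [hu0])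
  set g : ℝ → ℝ := fun x => k - V x * (u x ^ 2 / (u x ^ 2 + (v x / k) ^ 2) / k) with hg
  have huc : ContinuousOn u (Ici 0) := fun x hx => (hu x hx).continuousWithinAt
  have hvc : ContinuousOn v (Ici 0) := fun x hx => (hv x hx).continuousWithinAt
  have hgc : ContinuousOn g (Ici 0) := by
    refine continuousOn_const.sub (hV.continuousOn.mul (ContinuousOn.div_const ?_ k))
    exact (huc.pow 2).div ((huc.pow 2).add ((hvc.div_const k).pow 2)) fun x hx => (hr hx).ne'
  have hGc : Continuous fun x => g (max x 0) :=
    hgc.comp_continuous (continuous_id.max continuous_const) fun x => mem_Ici.2 (le_max_right _ _)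
  set θ : ℝ → ℝ := fun x => ∫ t in (0 : ℝ)..x, g (max t 0) with hθ
  have hθd' : ∀ x, HasDerivAt θ (g (max x 0)) x := fun x =>
    (hGc.integral_hasStrictDerivAt 0 x).hasDerivAt
  have hθd : ∀ x, 0 ≤ x → HasDerivAt θ (g x) x := fun x hx => by
    simpa [max_eq_left hx] using hθd' x
  have hθ0 : θ 0 = 0 := by simp [hθ]
  have hθc : Continuous θ := continuous_iff_continuousAt.2 fun x => (hθd' x).continuousAt
  set P : ℝ → ℝ := fun x =>
    (u x * Real.sin (θ x) + v x / k * Real.cos (θ x)) ^ 2 / (u x ^ 2 + (v x / k) ^ 2) with hP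
  have hPd : ∀ x ∈ Ici (0 : ℝ), HasDerivWithinAt P 0 (Ici 0) x := by
    intro x hx
    have hs : HasDerivWithinAt (fun x => Real.sin (θ x)) _ (Ici 0) x :=
      (hθd x hx).sin.hasDerivWithinAt
    have hc : HasDerivWithinAt (fun x => Real.cos (θ x)) _ (Ici 0) x :=
      (hθd x hx).cos.hasDerivWithinAt
    have hvk := (hv x hx).div_const k
    have h1 := (((hu x hx).mul hs).add (hvk.mul hc)).pow 2
    have h2 := ((hu x hx).pow 2).add (hvk.pow 2)
    refine (h1.div h2 (hr hx).ne').congr_deriv ?_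
    have hne := (hr hx).ne'
    rw [div_eq_zero_iff]
    left
    simp only [Pi.add_apply, Pi.pow_apply, Pi.mul_apply, Nat.reduceSub, pow_one, Nat.cast_ofNat, hg]
    generalize Real.sin (θ x) = s
    generalize Real.cos (θ x) = c
    have hne' : u x ^ 2 * k ^ 2 + v x ^ 2 ≠ 0 := by
      intro h
      apply hne
      field_simp
      rw [h, mul_zero]
    field_simp
    ring
  have hP0 : ∀ x, 0 ≤ x → u x * Real.sin (θ x) + v x / k * Real.cos (θ x) = 0 := by
    intro x hx
    have h := constant_of_has_deriv_right_zero (f := P) (a := 0) (b := x)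
      (fun y hy => ((hPd y hy.1).continuousWithinAt).mono Icc_subset_Ici_self)
      (fun y hy => (hPd y hy.1).mono (Ici_subset_Ici.2 hy.1)) x ⟨hx, le_rfl⟩
    have h00 : P 0 = 0 := by simp [hP, hθ0, hv0]
    rw [h00, hP, div_eq_zero_iff] at h
    exact pow_eq_zero_iff two_ne_zero |>.1 (h.resolve_right (hr hx).ne')
  refine ⟨θ, hθ0, hθc, fun x hx => ?_, fun x hx => ⟨fun h => ?_, fun h => ?_⟩⟩
  · have h1 := hP0 x hx
    have h2 : u x ^ 2 / (u x ^ 2 + (v x / k) ^ 2) = Real.cos (θ x) ^ 2 := by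
      rw [div_eq_iff (hr hx).ne']
      have h3 : (u x * Real.sin (θ x)) ^ 2 = (v x / k * Real.cos (θ x)) ^ 2 := by
        rw [eq_neg_of_add_eq_zero_left h1]; ring
      have h4 := Real.sin_sq_add_cos_sq (θ x)
      linear_combination h3 - u x ^ 2 * h4
    have h3 := hθd x hx
    rw [hg] at h3
    simpa only [h2] using h3
  · have h1 := hP0 x hx
    have h2 := hr hx
    have h3 : u x ≠ 0 := by
      rintro h3
      simp [h, h3] at h2
    simpa [h, h3] using h1
  · have h1 := hP0 x hx
    have h3 : Real.cos (θ x) ≠ 0 := by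
      intro h3
      have := Real.sin_sq_add_cos_sq (θ x)
      simp [h, h3] at this
    simpa [h, h3, hk.ne'] using h1

end PruferAngle

section Comparison

theorem abs_cos_sq_sub_cos_sq_le (a b : ℝ) : |Real.cos a ^ 2 - Real.cos b ^ 2| ≤ |a - b| := by
  have h : Real.cos a ^ 2 - Real.cos b ^ 2 = -(Real.sin (a + b) * Real.sin (a - b)) := by
    rw [Real.sin_add, Real.sin_sub]
    linear_combination (Real.cos b ^ 2) * Real.sin_sq_add_cos_sq a -
      (Real.cos a ^ 2) * Real.sin_sq_add_cos_sq b
  rw [h, abs_neg, abs_mul]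
  calc |Real.sin (a + b)| * |Real.sin (a - b)| ≤ 1 * |a - b| := by
        exact mul_le_mul (Real.abs_sin_le_one _) Real.abs_sin_le_abs (abs_nonneg _) zero_le_one
    _ = |a - b| := one_mul _

theorem abs_cos_sq_div_sub_le {κ k₁ k₂ : ℝ} (hκ : 0 < κ) (h₁ : κ ≤ k₁) (h₂ : κ ≤ k₂) (a b : ℝ) :
    |Real.cos b ^ 2 / k₂ - Real.cos a ^ 2 / k₁| ≤ 1 / κ * (|b - a| + |k₂ - k₁| * (1 / κ)) := by
  have hk₁ : 0 < k₁ := hκ.trans_le h₁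
  have hk₂ : 0 < k₂ := hκ.trans_le h₂
  have h : Real.cos b ^ 2 / k₂ - Real.cos a ^ 2 / k₁ =
      (Real.cos b ^ 2 - Real.cos a ^ 2) / k₂ - Real.cos a ^ 2 * ((k₂ - k₁) / (k₁ * k₂)) := by
    field_simp
    ring
  have h3 : |(Real.cos b ^ 2 - Real.cos a ^ 2) / k₂| ≤ |b - a| / κ := by
    rw [abs_div, abs_of_pos hk₂]
    exact div_le_div₀ (abs_nonneg _) (abs_cos_sq_sub_cos_sq_le b a) hκ h₂
  have h4 : |Real.cos a ^ 2 * ((k₂ - k₁) / (k₁ * k₂))| ≤ 1 * (|k₂ - k₁| / (κ * κ)) := by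
    rw [abs_mul, abs_div, abs_of_pos (mul_pos hk₁ hk₂)]
    gcongr
    rw [abs_of_nonneg (sq_nonneg _)]
    exact Real.cos_sq_le_one a
  calc _ ≤ |b - a| / κ + 1 * (|k₂ - k₁| / (κ * κ)) := by
        rw [h]
        exact (abs_sub _ _).trans (add_le_add h3 h4)
    _ = _ := by field_simp

theorem tendsto_zero_of_le_mul_add {s a b : ℕ → ℝ} (hs : ∀ n, 0 ≤ s n)
    (ha : Tendsto a atTop (𝓝 0)) (hb : Tendsto b atTop (𝓝 0))
    (h : ∀ n, s (n + 1) ≤ a n * s n + b n) : Tendsto s atTop (𝓝 0) := by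
  rw [Metric.tendsto_atTop]
  intro ε hε
  obtain ⟨n₀, hn₀⟩ := eventually_atTop.1
    ((ha.eventually_lt_const (by norm_num : (0 : ℝ) < 1 / 2)).and
      (hb.eventually_lt_const (by positivity : (0 : ℝ) < ε / 4)))
  have key : ∀ j, s (n₀ + j) ≤ s n₀ * (1 / 2) ^ j + ε / 2 := by
    intro j
    induction j with
    | zero => simp; positivity
    | succ j ih =>
      obtain ⟨h1, h2⟩ := hn₀ (n₀ + j) (Nat.le_add_right _ _)
      have h3 := h (n₀ + j)
      have h4 := mul_le_mul_of_nonneg_right h1.le (hs (n₀ + j))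
      rw [← add_assoc, pow_succ]
      linarith
  have hlim : Tendsto (fun j : ℕ => s n₀ * (1 / 2 : ℝ) ^ j) atTop (𝓝 0) := by
    simpa using (tendsto_pow_atTop_nhds_zero_of_lt_one (by norm_num : (0 : ℝ) ≤ 1 / 2)
      (by norm_num)).const_mul (s n₀)
  obtain ⟨j₀, hj₀⟩ := eventually_atTop.1
    (hlim.eventually_lt_const (by positivity : (0 : ℝ) < ε / 2))
  refine ⟨n₀ + j₀, fun n hn => ?_⟩
  obtain ⟨j, rfl⟩ := Nat.exists_eq_add_of_le (show n₀ ≤ n by omega)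
  have h1 := hj₀ j (by omega)
  rw [Real.dist_eq, sub_zero, abs_of_nonneg (hs _)]
  linarith [key j]

/-- The Gronwall majorant, at the start of the `n`-th bump, of the deviation of the Prüfer angle
difference from its free value, for a potential of size at most `κ * q n` on the `n`-th bump. -/
noncomputable def deviationBound (κ : ℝ) (q N : ℕ → ℝ) : ℕ → ℝ
  | 0 => 0
  | n + 1 => deviationBound κ q N n * Real.exp (q n) + (N n + 1 + 1 / κ) * (Real.exp (q n) - 1)

theorem deviationBound_nonneg {κ : ℝ} {q N : ℕ → ℝ} (hκ : 0 < κ) (hq : ∀ n, 0 ≤ q n)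
    (hN : ∀ n, 0 < N n) (n : ℕ) : 0 ≤ deviationBound κ q N n := by
  induction n with
  | zero => exact le_rfl
  | succ n ih =>
    have h1 := Real.one_le_exp (hq n)
    have h2 := hN n
    rw [deviationBound]
    have : 0 ≤ Real.exp (q n) - 1 := by linarith
    positivity

theorem tendsto_deviationBound_div {κ : ℝ} {q N : ℕ → ℝ} (hκ : 0 < κ) (hq : ∀ n, 0 ≤ q n)
    (hq0 : Tendsto q atTop (𝓝 0)) (hN : ∀ n, 0 < N n) (hNm : StrictMono N)
    (hNr : Tendsto (fun n => N n / N (n + 1)) atTop (𝓝 0)) :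
    Tendsto (fun n => deviationBound κ q N (n + 1) / N n) atTop (𝓝 0) := by
  have hq1 : Tendsto (fun n => q (n + 1)) atTop (𝓝 0) := hq0.comp (tendsto_add_atTop_nat 1)
  have hexp : Tendsto (fun n => Real.exp (q (n + 1))) atTop (𝓝 1) := by
    simpa [Function.comp_def] using (Real.continuous_exp.tendsto 0).comp hq1
  refine tendsto_zero_of_le_mul_add
    (a := fun n => N n / N (n + 1) * Real.exp (q (n + 1)))
    (b := fun n => (1 + (1 + 1 / κ) / N 0) * (Real.exp (q (n + 1)) - 1))
    (fun n => div_nonneg (deviationBound_nonneg hκ hq hN _) (hN n).le) ?_ ?_ fun n => ?_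
  · simpa using hNr.mul hexp
  · simpa using (hexp.sub_const 1).const_mul (1 + (1 + 1 / κ) / N 0)
  · have h0 := hN 0
    have h1 := hN n
    have h2 := hN (n + 1)
    have h3 : 0 ≤ Real.exp (q (n + 1)) - 1 := by linarith [Real.one_le_exp (hq (n + 1))]
    have h4 : (1 + 1 / κ) / N (n + 1) ≤ (1 + 1 / κ) / N 0 := by
      gcongr
      exact hNm.monotone (Nat.zero_le _)
    rw [deviationBound]
    calc (deviationBound κ q N (n + 1) * Real.exp (q (n + 1)) +
          (N (n + 1) + 1 + 1 / κ) * (Real.exp (q (n + 1)) - 1)) / N (n + 1)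
        = N n / N (n + 1) * Real.exp (q (n + 1)) * (deviationBound κ q N (n + 1) / N n) +
          (1 + (1 + 1 / κ) / N (n + 1)) * (Real.exp (q (n + 1)) - 1) := by
          field_simp
          ring
      _ ≤ _ := by gcongr

/-- Deviation of the difference of two Prüfer angles from its free value, for a sparse potential. -/
theorem abs_prufer_sub_le {V θ₁ θ₂ : ℝ → ℝ} {κ k₁ k₂ : ℝ} {q N : ℕ → ℝ} (hκ : 0 < κ)
    (h₁ : κ ≤ k₁) (h₂ : κ ≤ k₂) (hq : ∀ n, 0 ≤ q n) (hN : ∀ n, 0 < N n)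
    (hNN : ∀ n, N n + 1 < N (n + 1)) (hV0 : ∀ x ∈ Icc 0 (N 0), V x = 0)
    (hVn : ∀ n, ∀ x ∈ Icc (N n) (N n + 1), |V x| ≤ κ * q n)
    (hVg : ∀ n, ∀ x ∈ Icc (N n + 1) (N (n + 1)), V x = 0)
    (hθ₁ : ∀ x, 0 ≤ x → HasDerivAt θ₁ (k₁ - V x * (Real.cos (θ₁ x) ^ 2 / k₁)) x)
    (hθ₂ : ∀ x, 0 ≤ x → HasDerivAt θ₂ (k₂ - V x * (Real.cos (θ₂ x) ^ 2 / k₂)) x)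
    (h10 : θ₁ 0 = 0) (h20 : θ₂ 0 = 0) (n : ℕ) (x : ℝ) (hx : x ∈ Icc (N n) (N (n + 1))) :
    |θ₂ x - θ₁ x - (k₂ - k₁) * x| ≤ |k₂ - k₁| * deviationBound κ q N (n + 1) := by
  set E : ℝ → ℝ := fun x => θ₂ x - θ₁ x - (k₂ - k₁) * x with hE
  have hd : ∀ x, 0 ≤ x →
      HasDerivAt E (-(V x * (Real.cos (θ₂ x) ^ 2 / k₂ - Real.cos (θ₁ x) ^ 2 / k₁))) x := by
    intro x hx
    refine (((hθ₂ x hx).sub (hθ₁ x hx)).sub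
      ((hasDerivAt_id x).const_mul (k₂ - k₁))).congr_deriv ?_
    ring
  have hcont : ∀ a b, 0 ≤ a → ContinuousOn E (Icc a b) := fun a b ha y hy =>
    (hd y (ha.trans hy.1)).continuousAt.continuousWithinAt
  have hconst : ∀ a b, 0 ≤ a → (∀ y ∈ Icc a b, V y = 0) → ∀ y ∈ Icc a b, E y = E a := by
    intro a b ha hV
    refine constant_of_has_deriv_right_zero (hcont a b ha) fun y hy => ?_
    have := hd y (ha.trans hy.1)
    rw [hV y ⟨hy.1, hy.2.le⟩, zero_mul, neg_zero] at this
    exact this.hasDerivWithinAt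
  have hstep : ∀ n, |E (N n)| ≤ |k₂ - k₁| * deviationBound κ q N n →
      ∀ x ∈ Icc (N n) (N (n + 1)), |E x| ≤ |k₂ - k₁| * deviationBound κ q N (n + 1) := by
    intro n hn
    have hbump : ∀ x ∈ Icc (N n) (N n + 1),
        |E x| ≤ |k₂ - k₁| * deviationBound κ q N (n + 1) := by
      intro x hx
      have hg := norm_le_gronwallBound_of_norm_deriv_right_le (f := E)
        (f' := fun x => -(V x * (Real.cos (θ₂ x) ^ 2 / k₂ - Real.cos (θ₁ x) ^ 2 / k₁)))
        (δ := |k₂ - k₁| * deviationBound κ q N n) (K := q n)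
        (ε := q n * (|k₂ - k₁| * (N n + 1 + 1 / κ))) (hcont (N n) (N n + 1) (hN n).le)
        (fun y hy => (hd y ((hN n).le.trans hy.1)).hasDerivWithinAt) hn
        (fun y hy => by
          have hy0 : 0 ≤ y := (hN n).le.trans hy.1
          have e1 := abs_cos_sq_div_sub_le hκ h₁ h₂ (θ₁ y) (θ₂ y)
          have e2 := hVn n y ⟨hy.1, hy.2.le⟩
          have e3 : |θ₂ y - θ₁ y| ≤ |E y| + |k₂ - k₁| * (N n + 1) := by
            have : θ₂ y - θ₁ y = E y + (k₂ - k₁) * y := by simp only [hE]; ring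
            rw [this]
            refine (abs_add_le _ _).trans ?_
            rw [abs_mul, abs_of_nonneg hy0]
            gcongr
            exact hy.2.le
          rw [norm_neg, Real.norm_eq_abs, Real.norm_eq_abs, abs_mul]
          have hqn := hq n
          calc _ ≤ κ * q n * (1 / κ * (|θ₂ y - θ₁ y| + |k₂ - k₁| * (1 / κ))) := by gcongr
            _ = q n * (|θ₂ y - θ₁ y| + |k₂ - k₁| * (1 / κ)) := by field_simp
            _ ≤ q n * (|E y| + |k₂ - k₁| * (N n + 1) + |k₂ - k₁| * (1 / κ)) := by gcongr
            _ = _ := by ring) x hx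
      rw [Real.norm_eq_abs] at hg
      refine hg.trans ?_
      have hd0 := deviationBound_nonneg hκ hq hN n
      have hNn := hN n
      have hqn := hq n
      refine (gronwallBound_mono (by positivity) (by positivity) hqn
        (by linarith [hx.2] : x - N n ≤ 1)).trans ?_
      rcases hqn.eq_or_lt with h0 | h0
      · rw [deviationBound, ← h0, gronwallBound_K0]
        simp
      · rw [deviationBound, gronwallBound_of_K_ne_0 h0.ne']
        simp only [mul_one]
        apply le_of_eq
        field_simp
    intro x hx
    rcases le_total x (N n + 1) with h | h
    · exact hbump x ⟨hx.1, h⟩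
    · rw [hconst (N n + 1) (N (n + 1)) (by linarith [hN n]) (hVg n) x ⟨h, hx.2⟩]
      exact hbump _ ⟨by linarith, le_rfl⟩
  have hstart : ∀ n, |E (N n)| ≤ |k₂ - k₁| * deviationBound κ q N n := by
    intro n
    induction n with
    | zero =>
      rw [hconst 0 (N 0) le_rfl hV0 (N 0) ⟨(hN 0).le, le_rfl⟩]
      simp [hE, h10, h20, deviationBound]
    | succ n ih => exact hstep n ih _ ⟨by linarith [hNN n], le_rfl⟩
  exact hstep n (hstart n) x hx

end Comparison

section Counting

theorem sub_le_of_ncard_le {f g : ℝ → ℝ} {k₁ k₂ : ℝ} {S : Set ℝ} {m : ℕ}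
    (hf : ContinuousOn f (Icc k₁ k₂)) (hk : k₁ ≤ k₂) (hg : InjOn g (Ioo k₁ k₂))
    (hS : S.Finite) (hgS : ∀ k ∈ Ioo k₁ k₂, Real.sin (f k) = 0 → g k ∈ S) (hm : S.ncard ≤ m) :
    f k₂ - f k₁ ≤ (m + 1) * π := by
  by_contra! hlt
  have hπ := Real.pi_pos
  set j := ⌊f k₁ / π⌋ + 1 with hj
  have hj1 : f k₁ < j * π := by
    rw [← div_lt_iff₀ hπ, hj]
    push_cast
    exact Int.lt_floor_add_one _
  have hj2 : j * π ≤ f k₁ + π := by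
    have := (le_div_iff₀ hπ).1 (Int.floor_le (f k₁ / π))
    rw [hj]
    push_cast
    linarith
  have hex : ∀ i ∈ Finset.range (m + 1), ∃ k ∈ Ioo k₁ k₂, f k = (j + i) * π := by
    intro i hi
    have hi' : (i : ℝ) ≤ m := by exact_mod_cast Nat.lt_succ_iff.1 (Finset.mem_range.1 hi)
    obtain ⟨k, hk, hfk⟩ := intermediate_value_Ioo hk hf
      (show (j + i : ℝ) * π ∈ Ioo (f k₁) (f k₂) by
        constructor
        · have : (0 : ℝ) ≤ i * π := by positivity
          linarith
        · have : (i : ℝ) * π ≤ m * π := by gcongr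
          linarith)
    exact ⟨k, hk, hfk⟩
  choose! p hp hfp using hex
  have hcard : (Finset.range (m + 1)).card ≤ hS.toFinset.card := by
    refine Finset.card_le_card_of_injOn (fun i => g (p i)) (fun i hi => ?_) fun i hi i' hi' h => ?_
    · simp only [Finite.coe_toFinset]
      refine hgS _ (hp i hi) ?_
      rw [hfp i hi]
      exact_mod_cast Real.sin_int_mul_pi (j + i)
    · have h1 := congrArg f (hg (hp i hi) (hp i' hi') h)
      rw [hfp i hi, hfp i' hi'] at h1
      exact_mod_cast add_left_cancel (mul_right_cancel₀ hπ.ne' h1)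
  rw [Finset.card_range, ← ncard_eq_toFinset_card S hS] at hcard
  omega

theorem IsNthPoint.lt_and_inter_Ioo_eq_empty {Z : Set ℝ} {c x y : ℝ} {n : ℤ}
    (hx : IsNthPoint Z c n x) (hy : IsNthPoint Z c (n + 1) y) : x < y ∧ Z ∩ Ioo x y = ∅ := by
  obtain ⟨hxZ, ⟨hn, hcx, hxf, hxc⟩ | ⟨hn, hxc', hxf, hxc⟩⟩ := hx <;>
    obtain ⟨hyZ, ⟨hn', hcy, hyf, hyc⟩ | ⟨hn', hyc', hyf, hyc⟩⟩ := hy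
  · have hxy : x < y := by
      by_contra! h
      have := ncard_le_ncard (inter_subset_inter_right Z
        (Ico_subset_Ico_right h : Ico c y ⊆ Ico c x)) hxf
      omega
    refine ⟨hxy, eq_empty_of_forall_notMem fun z hz => ?_⟩
    have hsub : insert x (Z ∩ Ico c x) ⊆ Z ∩ Ico c y := by
      rintro w (rfl | hw)
      · exact ⟨hxZ, hcx, hxy⟩
      · exact ⟨hw.1, hw.2.1, hw.2.2.trans hxy⟩
    have heq := eq_of_subset_of_ncard_le hsub (by
      rw [ncard_insert_of_notMem (fun h => lt_irrefl _ h.2.2) hxf]; omega) hyf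
    have hz' : z ∈ insert x (Z ∩ Ico c x) := by
      rw [heq]
      exact ⟨hz.1, hcx.trans hz.2.1.le, hz.2.2⟩
    rcases hz' with rfl | hz'
    · exact lt_irrefl _ hz.2.1
    · exact lt_asymm hz.2.1 hz'.2.2
  · omega
  · refine ⟨hxc'.trans_le hcy, eq_empty_of_forall_notMem fun z hz => ?_⟩
    have hx0 := (ncard_eq_zero hxf).1 (by omega)
    have hy0 := (ncard_eq_zero hyf).1 (by omega)
    rcases lt_or_ge z c with h | h
    · exact notMem_empty z (hx0 ▸ ⟨hz.1, hz.2.1, h⟩)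
    · exact notMem_empty z (hy0 ▸ ⟨hz.1, h, hz.2.2⟩)
  · have hxy : x < y := by
      by_contra! h
      have := ncard_le_ncard (inter_subset_inter_right Z
        (Ioo_subset_Ioo_left h : Ioo x c ⊆ Ioo y c)) hyf
      omega
    refine ⟨hxy, eq_empty_of_forall_notMem fun z hz => ?_⟩
    have hsub : insert y (Z ∩ Ioo y c) ⊆ Z ∩ Ioo x c := by
      rintro w (rfl | hw)
      · exact ⟨hyZ, hxy, hyc'⟩
      · exact ⟨hw.1, hxy.trans hw.2.1, hw.2.2⟩
    have heq := eq_of_subset_of_ncard_le hsub (by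
      rw [ncard_insert_of_notMem (fun h => lt_irrefl _ h.2.1) hyf]; omega) hxf
    have hz' : z ∈ insert y (Z ∩ Ioo y c) := by
      rw [heq]
      exact ⟨hz.1, hz.2.1, hz.2.2.trans hyc'⟩
    rcases hz' with rfl | hz'
    · exact lt_irrefl _ hz.2.2
    · exact lt_asymm hz.2.2 hz'.2.1

theorem sq_injOn_Ioo {a b : ℝ} (ha : 0 ≤ a) : InjOn (fun k : ℝ => k ^ 2) (Ioo a b) :=
  fun _ hx _ hy h => (pow_left_inj₀ (ha.trans hx.1.le) (ha.trans hy.1.le) two_ne_zero).1 h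

section Phase

variable {f : ℝ → ℝ} {κ δ L : ℝ} {Z : Set ℝ}

theorem continuousOn_of_abs_sub_le
    (hf : ∀ k₁, κ ≤ k₁ → ∀ k₂, κ ≤ k₂ → |f k₂ - f k₁ - (k₂ - k₁) * L| ≤ δ * L * |k₂ - k₁|) :
    ContinuousOn f (Ici κ) := by
  have h : LipschitzOnWith (Real.toNNReal (δ * L + |L|)) f (Ici κ) := by
    refine LipschitzOnWith.of_dist_le' fun k₂ h₂ k₁ h₁ => ?_
    have h1 := hf k₁ h₁ k₂ h₂
    rw [Real.dist_eq, Real.dist_eq]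
    calc |f k₂ - f k₁| = |(f k₂ - f k₁ - (k₂ - k₁) * L) + (k₂ - k₁) * L| := by ring_nf
      _ ≤ |f k₂ - f k₁ - (k₂ - k₁) * L| + |(k₂ - k₁) * L| := abs_add_le _ _
      _ ≤ δ * L * |k₂ - k₁| + |k₂ - k₁| * |L| := by rw [abs_mul]; gcongr
      _ = _ := by ring
  exact h.continuousOn

theorem mul_sub_le_of_abs_sub_le
    (hf : ∀ k₁, κ ≤ k₁ → ∀ k₂, κ ≤ k₂ → |f k₂ - f k₁ - (k₂ - k₁) * L| ≤ δ * L * |k₂ - k₁|)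
    {k₁ k₂ : ℝ} (h₁ : κ ≤ k₁) (h : k₁ ≤ k₂) : (1 - δ) * L * (k₂ - k₁) ≤ f k₂ - f k₁ := by
  have h1 := (abs_le.1 (hf k₁ h₁ k₂ (h₁.trans h))).1
  rw [abs_of_nonneg (sub_nonneg.2 h)] at h1
  linarith

theorem IsNthPoint.sqrt_close (hκ : 0 < κ)
    (hf : ∀ k₁, κ ≤ k₁ → ∀ k₂, κ ≤ k₂ → |f k₂ - f k₁ - (k₂ - k₁) * L| ≤ δ * L * |k₂ - k₁|)
    (hZ : ∀ k, κ ≤ k → Real.sin (f k) = 0 → k ^ 2 ∈ Z) {c x : ℝ} {n : ℤ}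
    (hc : κ ≤ √c) (hc' : (|(n : ℝ)| + 1) * π < (1 - δ) * L * (√c - κ))
    (hx : IsNthPoint Z c n x) :
    κ ≤ √x ∧ (1 - δ) * L * |√x - √c| ≤ (|(n : ℝ)| + 1) * π := by
  have hfc := continuousOn_of_abs_sub_le hf
  obtain ⟨-, ⟨hn, hcx, hxf, hxc⟩ | ⟨hn, hxc', hxf, hxc⟩⟩ := hx
  · have hle : √c ≤ √x := Real.sqrt_le_sqrt hcx
    refine ⟨hc.trans hle, ?_⟩
    rw [abs_of_nonneg (sub_nonneg.2 hle)]
    have h1 := sub_le_of_ncard_le (f := f) (g := fun k => k ^ 2) (k₁ := √c) (k₂ := √x)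
      (hfc.mono fun k hk => hc.trans hk.1) hle (sq_injOn_Ioo (Real.sqrt_nonneg _)) hxf
      (fun k hk hs => ⟨hZ k (hc.trans hk.1.le) hs, (Real.lt_sq_of_sqrt_lt hk.1).le,
        (Real.lt_sqrt ((Real.sqrt_nonneg _).trans hk.1.le)).1 hk.2⟩) hxc.le
    have h2 : ((n.toNat : ℕ) : ℝ) = |(n : ℝ)| := by
      rw [abs_of_nonneg (by exact_mod_cast hn)]
      exact_mod_cast Int.toNat_of_nonneg hn
    rw [h2] at h1
    exact (mul_sub_le_of_abs_sub_le hf hc hle).trans h1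
  · set k' := max κ √x with hk'
    have hκk : κ ≤ k' := le_max_left _ _
    have hle : k' ≤ √c := max_le hc (Real.sqrt_le_sqrt hxc'.le)
    have h1 := sub_le_of_ncard_le (f := f) (g := fun k => k ^ 2) (k₁ := k') (k₂ := √c)
      (hfc.mono fun k hk => hκk.trans hk.1) hle (sq_injOn_Ioo (hκ.le.trans hκk)) hxf
      (fun k hk hs => ⟨hZ k (hκk.trans hk.1.le) hs,
        Real.lt_sq_of_sqrt_lt ((le_max_right _ _).trans_lt hk.1),
        (Real.lt_sqrt ((hκ.le.trans hκk).trans hk.1.le)).1 hk.2⟩) hxc.le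
    have h2 : (((-n - 1).toNat : ℕ) : ℝ) + 1 = |(n : ℝ)| := by
      rw [abs_of_neg (by exact_mod_cast hn)]
      have : (((-n - 1).toNat : ℕ) : ℤ) + 1 = -n := by omega
      exact_mod_cast this
    rw [h2] at h1
    have h3 := mul_sub_le_of_abs_sub_le hf hκk hle
    have h4 : κ < √x := by
      by_contra! h
      rw [hk', max_eq_left h] at h1 h3
      linarith [Real.pi_pos]
    rw [hk', max_eq_right h4.le] at h1 h3
    refine ⟨h4.le, ?_⟩
    rw [abs_sub_comm, abs_of_nonneg (sub_nonneg.2 (Real.sqrt_le_sqrt hxc'.le))]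
    linarith [Real.pi_pos]

theorem phase_sub_eq_pi (hκ : 0 < κ) (hδ : δ < 1) (hL : 0 < L)
    (hf : ∀ k₁, κ ≤ k₁ → ∀ k₂, κ ≤ k₂ → |f k₂ - f k₁ - (k₂ - k₁) * L| ≤ δ * L * |k₂ - k₁|)
    (hZ : ∀ k, κ ≤ k → (k ^ 2 ∈ Z ↔ Real.sin (f k) = 0)) {k₁ k₂ : ℝ} (h₁ : κ ≤ k₁) (h₂ : k₁ < k₂)
    (hZ₁ : k₁ ^ 2 ∈ Z) (hZ₂ : k₂ ^ 2 ∈ Z) (hempty : Z ∩ Ioo (k₁ ^ 2) (k₂ ^ 2) = ∅) :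
    f k₂ - f k₁ = π := by
  obtain ⟨i, hi⟩ := Real.sin_eq_zero_iff.1 ((hZ k₁ h₁).1 hZ₁)
  obtain ⟨j, hj⟩ := Real.sin_eq_zero_iff.1 ((hZ k₂ (h₁.trans h₂.le)).1 hZ₂)
  have hπ := Real.pi_pos
  have hpos : 0 < f k₂ - f k₁ := by
    refine lt_of_lt_of_le ?_ (mul_sub_le_of_abs_sub_le hf h₁ h₂.le)
    exact mul_pos (mul_pos (sub_pos.2 hδ) hL) (sub_pos.2 h₂)
  have hij : i < j := by
    rw [← hi, ← hj, ← sub_mul] at hpos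
    exact_mod_cast sub_pos.1 (pos_of_mul_pos_left hpos hπ.le)
  have hupper := sub_le_of_ncard_le (f := f) (g := fun k => k ^ 2) (S := ∅) (m := 0)
    ((continuousOn_of_abs_sub_le hf).mono fun k hk => h₁.trans hk.1) h₂.le
    (sq_injOn_Ioo (hκ.le.trans h₁)) finite_empty (fun k hk hs => by
      have hk0 : 0 ≤ k := hκ.le.trans (h₁.trans hk.1.le)
      rw [← hempty]
      exact ⟨(hZ k (h₁.trans hk.1.le)).2 hs,
        pow_lt_pow_left₀ hk.1 (hκ.le.trans h₁) two_ne_zero,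
        pow_lt_pow_left₀ hk.2 hk0 two_ne_zero⟩) (by simp)
  have hj1 : j = i + 1 := by
    refine le_antisymm ?_ hij
    rw [← hi, ← hj, ← sub_mul] at hupper
    have := le_of_mul_le_mul_right hupper hπ
    have h' : (j : ℝ) ≤ i + 1 := by push_cast at this; linarith
    exact_mod_cast h'
  rw [← hi, ← hj, hj1]
  push_cast
  ring

/-- Uniform clock spacing from an almost linear phase. -/
theorem abs_spacing_sub_one_lt {ε : ℝ} (hκ : 0 < κ) (hL : 0 < L) (hε : 0 < ε)
    (hδ : 0 ≤ δ) (hδ1 : δ ≤ 1 / 2) (hδε : δ ≤ ε / 8)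
    (hf : ∀ k₁, κ ≤ k₁ → ∀ k₂, κ ≤ k₂ → |f k₂ - f k₁ - (k₂ - k₁) * L| ≤ δ * L * |k₂ - k₁|)
    (hZ : ∀ k, κ ≤ k → (k ^ 2 ∈ Z ↔ Real.sin (f k) = 0)) {c x y : ℝ} {n : ℤ} (hc : 2 * κ ≤ √c)
    {η : ℝ} (hη1 : η ≤ 1) (hηε : η ≤ ε / 4)
    (hLη : 2 * ((|(n : ℝ)| + 2) * π) < L * κ * η)
    (hx : IsNthPoint Z c n x) (hy : IsNthPoint Z c (n + 1) y) :
    |L * (y - x) * (1 / (2 * π * √c)) - 1| < ε := by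
  have hπ := Real.pi_pos
  have hn1 : |((n + 1 : ℤ) : ℝ)| ≤ |(n : ℝ)| + 1 := by
    push_cast
    simpa using abs_add_le (n : ℝ) 1
  have hLκ : 0 < L * κ := mul_pos hL hκ
  set C := (|(n : ℝ)| + 2) * π with hC
  have hbig : C < (1 - δ) * L * (√c - κ) := by
    have h1 : L * κ * η ≤ L * κ := mul_le_of_le_one_right hLκ.le hη1
    have h2 : L * κ ≤ L * (√c - κ) := by gcongr; linarith
    have h3 : 1 / 2 * (L * (√c - κ)) ≤ (1 - δ) * (L * (√c - κ)) := by
      have := hLκ.le.trans h2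
      gcongr
      linarith
    linarith
  have hC1 : (|(n : ℝ)| + 1) * π ≤ C := mul_le_mul_of_nonneg_right (by linarith) hπ.le
  have hC2 : (|((n + 1 : ℤ) : ℝ)| + 1) * π ≤ C := mul_le_mul_of_nonneg_right (by linarith) hπ.le
  obtain ⟨hxκ, hxc⟩ := hx.sqrt_close hκ hf (fun k hk => (hZ k hk).2) (by linarith)
    (hC1.trans_lt hbig)
  obtain ⟨hyκ, hyc⟩ := hy.sqrt_close hκ hf (fun k hk => (hZ k hk).2) (by linarith)
    (hC2.trans_lt hbig)
  obtain ⟨hxy, hempty⟩ := hx.lt_and_inter_Ioo_eq_empty hy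
  have hx0 : 0 < x := Real.sqrt_pos.1 (hκ.trans_le hxκ)
  have hy0 : 0 < y := Real.sqrt_pos.1 (hκ.trans_le hyκ)
  have hx2 := Real.sq_sqrt hx0.le
  have hy2 := Real.sq_sqrt hy0.le
  have hlt : √x < √y := Real.sqrt_lt_sqrt hx0.le hxy
  have hphase : f √y - f √x = π :=
    phase_sub_eq_pi hκ (by linarith) hL hf hZ hxκ hlt (by rw [hx2]; exact hx.1)
      (by rw [hy2]; exact hy.1) (by rw [hx2, hy2]; exact hempty)
  have hdiff := hf _ hxκ _ hyκ
  rw [hphase, abs_of_pos (sub_pos.2 hlt)] at hdiff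
  have hs : 0 < √c := by linarith
  have close : ∀ k, (1 - δ) * L * |k - √c| ≤ C → |k - √c| ≤ η * √c := by
    intro k hk
    have h1 : 1 / 2 * (L * |k - √c|) ≤ (1 - δ) * (L * |k - √c|) := by
      gcongr
      linarith
    have h2 : L * |k - √c| ≤ L * (κ * η) := by linarith
    have h3 := le_of_mul_le_mul_left h2 hL
    have hη0 : 0 ≤ η := by
      have : 0 ≤ κ * η := (abs_nonneg _).trans h3
      exact nonneg_of_mul_nonneg_right this hκ
    have : κ * η ≤ √c * η := by gcongr; linarith
    linarith
  have hA : |L * (√y - √x) / π - 1| ≤ 2 * δ := by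
    set A := L * (√y - √x) with hA
    have hA0 : 0 ≤ A := mul_nonneg hL.le (sub_nonneg.2 hlt.le)
    have h1 : |π - A| ≤ δ * A := by
      convert hdiff using 1 <;> rw [hA]
      · rw [mul_comm]
      · ring
    have h2 : A ≤ 2 * π := by
      have h3 := (abs_le.1 h1).1
      have h4 : δ * A ≤ 1 / 2 * A := by gcongr
      linarith
    have h3 : A / π - 1 = -((π - A) / π) := by field_simp; ring
    rw [h3, abs_neg, abs_div, abs_of_pos hπ, div_le_iff₀ hπ]
    have h4 : δ * A ≤ δ * (2 * π) := by gcongr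
    linarith
  have hB : |(√x + √y) / (2 * √c) - 1| ≤ η := by
    have h3 : (√x + √y) / (2 * √c) - 1 = ((√x - √c) + (√y - √c)) / (2 * √c) := by
      field_simp
      ring
    rw [h3, abs_div, abs_of_pos (by positivity : 0 < 2 * √c), div_le_iff₀ (by positivity)]
    refine (abs_add_le _ _).trans ?_
    have h1 := close _ (hxc.trans hC1)
    have h2 := close _ (hyc.trans hC2)
    linarith
  have hprod : L * (y - x) * (1 / (2 * π * √c)) =
      (L * (√y - √x) / π) * ((√x + √y) / (2 * √c)) := by
    have : y - x = (√y - √x) * (√x + √y) := by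
      rw [← hx2, ← hy2, Real.sqrt_sq (Real.sqrt_nonneg _), Real.sqrt_sq (Real.sqrt_nonneg _)]
      ring
    rw [this]
    field_simp
  rw [hprod]
  set A := L * (√y - √x) / π
  set B := (√x + √y) / (2 * √c)
  have hBb : |B| ≤ 2 := by
    have := abs_add_le (B - 1) 1
    rw [sub_add_cancel, abs_one] at this
    linarith
  calc |A * B - 1| = |(A - 1) * B + (B - 1)| := by ring_nf
    _ ≤ |A - 1| * |B| + |B - 1| := by rw [← abs_mul]; exact abs_add_le _ _
    _ ≤ 2 * δ * 2 + η := by gcongr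
    _ < ε := by linarith

end Phase

end Counting

section Pearson

variable {W : ℝ → ℝ} {lam N : ℕ → ℝ}

theorem eq_zero_of_notMem_Ioo (hW : Continuous W) (hs : Function.support W ⊆ Icc 0 1) {x : ℝ}
    (hx : x ∉ Ioo (0 : ℝ) 1) : W x = 0 := by
  by_contra h
  have h1 : Function.support W ⊆ Ioo 0 1 :=
    interior_Icc (a := (0 : ℝ)) (b := 1) ▸ interior_maximal hs hW.isOpen_support
  exact hx (h1 h)

theorem add_one_lt_of_lt (hN : ∀ n, N n + 1 < N (n + 1)) {m n : ℕ} (h : m < n) :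
    N m + 1 < N n :=
  (hN m).trans_le ((strictMono_nat_of_lt_succ fun n => by linarith [hN n]).monotone h)

theorem tsum_pearson_eq_single (hW : ∀ x ∉ Ioo (0 : ℝ) 1, W x = 0)
    (hN : ∀ n, N n + 1 < N (n + 1)) {n : ℕ} {x : ℝ} (hx : x ∈ Icc (N n) (N n + 1)) :
    ∑' m, lam m * W (x - N m) = lam n * W (x - N n) := by
  refine tsum_eq_single n fun m hm => ?_
  rw [hW, mul_zero]
  rintro ⟨h1, h2⟩
  rcases hm.lt_or_gt with h | h
  · linarith [add_one_lt_of_lt hN h, hx.1]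
  · linarith [add_one_lt_of_lt hN h, hx.2]

theorem tsum_pearson_eq_zero (hW : ∀ x ∉ Ioo (0 : ℝ) 1, W x = 0)
    {x : ℝ} (hx : ∀ n, x ∉ Ioo (N n) (N n + 1)) : ∑' m, lam m * W (x - N m) = 0 := by
  refine (tsum_congr fun m => ?_).trans tsum_zero
  rw [hW, mul_zero]
  rintro ⟨h1, h2⟩
  exact hx m ⟨by linarith, by linarith⟩

theorem tendsto_atTop_of_add_one_lt (hN : ∀ n, N n + 1 < N (n + 1)) : Tendsto N atTop atTop := by
  have h : ∀ n : ℕ, N 0 + n ≤ N n := by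
    intro n
    induction n with
    | zero => simp
    | succ n ih =>
      push_cast
      linarith [hN n]
  exact tendsto_atTop_mono h (tendsto_atTop_add_const_left _ _ tendsto_natCast_atTop_atTop)

theorem continuous_pearson (hWc : Continuous W) (hW : ∀ x ∉ Ioo (0 : ℝ) 1, W x = 0)
    (hN : ∀ n, N n + 1 < N (n + 1)) : Continuous fun x => ∑' m, lam m * W (x - N m) := by
  refine continuous_iff_continuousAt.2 fun x => ?_
  obtain ⟨n, hn⟩ := ((tendsto_atTop_of_add_one_lt hN).eventually_gt_atTop x).exists
  have hc : Continuous fun x => ∑ m ∈ Finset.range n, lam m * W (x - N m) := by fun_prop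
  refine hc.continuousAt.congr ?_
  filter_upwards [Iio_mem_nhds hn] with y hy
  refine (tsum_eq_sum fun m hm => ?_).symm
  have hnm : N n ≤ N m := (strictMono_nat_of_lt_succ fun n => by linarith [hN n]).monotone
    (not_lt.1 (Finset.mem_range.not.1 hm))
  rw [hW, mul_zero]
  rintro ⟨h1, -⟩
  linarith [mem_Iio.1 hy]

theorem exists_mem_Icc_of_le {m : ℕ} (hNt : Tendsto N atTop atTop) {L : ℝ} (hL : N m ≤ L) :
    ∃ n, m ≤ n ∧ L ∈ Icc (N n) (N (n + 1)) := by
  have hex : ∃ j, L < N (m + j) := by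
    obtain ⟨n, hn, hmn⟩ := ((hNt.eventually_gt_atTop L).and (eventually_ge_atTop m)).exists
    exact ⟨n - m, by rwa [Nat.add_sub_cancel' hmn]⟩
  classical
  have h1 := Nat.find_spec hex
  obtain ⟨j, hj⟩ : ∃ j, Nat.find hex = j + 1 := by
    refine Nat.exists_eq_succ_of_ne_zero fun h => ?_
    rw [h] at h1
    exact absurd h1 (not_lt.2 hL)
  rw [hj] at h1
  exact ⟨m + j, Nat.le_add_right _ _, not_lt.1 (Nat.find_min hex (by omega)), h1.le⟩

/-- Sparse Pearson potentials with vanishing amplitudes exhibit uniform clock behavior. -/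
theorem pearson_uniform_clock (hWc : Continuous W) (hWs : Function.support W ⊆ Icc 0 1)
    (hlam : Tendsto lam atTop (𝓝 0)) (hNpos : ∀ n, 0 < N n) (hN : ∀ n, N n + 1 < N (n + 1))
    (hNr : Tendsto (fun n => N n / N (n + 1)) atTop (𝓝 0)) (u ux : ℝ → ℝ → ℝ)
    (hu : ∀ ξ : ℝ, ∀ x ∈ Ici (0 : ℝ), HasDerivWithinAt (u ξ) (ux ξ x) (Ici 0) x)
    (hux : ∀ ξ : ℝ, ∀ x ∈ Ici (0 : ℝ),
      HasDerivWithinAt (ux ξ) (((∑' n, lam n * W (x - N n)) - ξ) * u ξ x) (Ici 0) x)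
    (hu0 : ∀ ξ : ℝ, u ξ 0 = 1) (hux0 : ∀ ξ : ℝ, ux ξ 0 = 0)
    {a : ℝ} (ha : 0 < a) (n : ℤ) {ε : ℝ} (hε : 0 < ε) :
    ∃ L₀ : ℝ, ∀ L : ℝ, L₀ ≤ L → ∀ ξs ∈ Ici a, ∀ x y : ℝ,
      IsNthPoint {ξ : ℝ | ux ξ L = 0} ξs n x →
      IsNthPoint {ξ : ℝ | ux ξ L = 0} ξs (n + 1) y →
      |L * (y - x) * (1 / (2 * π * √ξs)) - 1| < ε := by
  have hW : ∀ x ∉ Ioo (0 : ℝ) 1, W x = 0 := fun x => eq_zero_of_notMem_Ioo hWc hWs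
  have hNt := tendsto_atTop_of_add_one_lt hN
  have hNm : StrictMono N := strictMono_nat_of_lt_succ fun n => by linarith [hN n]
  obtain ⟨w, hw⟩ := (isCompact_Icc (a := (0 : ℝ)) (b := 1)).exists_bound_of_continuousOn
    hWc.continuousOn
  have hWb : ∀ x, |W x| ≤ |w| := fun x => by
    by_cases hx : x ∈ Ioo (0 : ℝ) 1
    · exact (hw x (Ioo_subset_Icc_self hx)).trans (le_abs_self w)
    · rw [hW x hx, abs_zero]
      exact abs_nonneg w
  obtain ⟨Λ, hΛ⟩ := hlam.abs.bddAbove_range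
  have hΛ' : ∀ n, |lam n| ≤ Λ := fun n => hΛ (mem_range_self n)
  have hΛ0 : 0 ≤ Λ := (abs_nonneg _).trans (hΛ' 0)
  set V : ℝ → ℝ := fun x => ∑' m, lam m * W (x - N m) with hV
  have hVc : Continuous V := continuous_pearson hWc hW hN
  have hVn : ∀ n, ∀ x ∈ Icc (N n) (N n + 1), |V x| ≤ |lam n| * |w| := by
    intro n x hx
    rw [hV]
    beta_reduce
    rw [tsum_pearson_eq_single hW hN hx, abs_mul]
    exact mul_le_mul_of_nonneg_left (hWb _) (abs_nonneg _)
  have hVM : ∀ x, |V x| ≤ Λ * |w| := by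
    intro x
    by_cases h : ∃ n, x ∈ Ioo (N n) (N n + 1)
    · obtain ⟨n, hn⟩ := h
      refine (hVn n x (Ioo_subset_Icc_self hn)).trans ?_
      gcongr
      exact hΛ' n
    · have h0 : V x = 0 := tsum_pearson_eq_zero hW (not_exists.1 h)
      rw [h0, abs_zero]
      positivity
  have hV0 : ∀ x ∈ Icc 0 (N 0), V x = 0 := fun x hx =>
    tsum_pearson_eq_zero hW fun m hm => by
      linarith [hm.1, hx.2, hNm.monotone (Nat.zero_le m)]
  have hVg : ∀ n, ∀ x ∈ Icc (N n + 1) (N (n + 1)), V x = 0 := fun n x hx =>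
    tsum_pearson_eq_zero hW fun m hm => by
      rcases le_or_gt m n with h | h
      · linarith [hm.2, hx.1, hNm.monotone h]
      · linarith [hm.1, hx.2, hNm.monotone (Nat.succ_le_of_lt h)]
  have hangle : ∀ k : ℝ, 0 < k → _ := fun k hk =>
    exists_prufer_angle (u := u (k ^ 2)) (v := ux (k ^ 2)) hk hVc hVM (hu _) (hux _) (hu0 _)
      (hux0 _)
  choose! θ hθ0 _ hθd hθz using hangle
  set κ := √a / 2 with hκdef
  have hκ : 0 < κ := by positivity
  set q : ℕ → ℝ := fun n => |lam n| * |w| / κ with hq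
  have hq0 : ∀ n, 0 ≤ q n := fun n => by positivity
  have hqt : Tendsto q atTop (𝓝 0) := by
    simpa using (hlam.abs.mul_const |w|).div_const κ
  set δ := min (1 / 2) (ε / 8) with hδdef
  have hδ : 0 < δ := by positivity
  set η := min 1 (ε / 4) with hηdef
  have hη : 0 < η := by positivity
  obtain ⟨n₀, hn₀⟩ := eventually_atTop.1
    ((tendsto_deviationBound_div hκ hq0 hqt hNpos hNm hNr).eventually_lt_const hδ)
  refine ⟨max (N n₀) (2 * ((|(n : ℝ)| + 2) * π) / (κ * η) + 1), fun L hL ξs hξs x y hx hy => ?_⟩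
  obtain ⟨j, hj, hLj⟩ := exists_mem_Icc_of_le hNt ((le_max_left _ _).trans hL)
  have hL0 : 0 < L := (hNpos j).trans_le hLj.1
  refine abs_spacing_sub_one_lt (f := fun k => θ k L) (δ := δ) (η := η) hκ hL0 hε hδ.le
    (min_le_left _ _) (min_le_right _ _) (fun k₁ h₁ k₂ h₂ => ?_) (fun k hk => ?_) ?_
    (min_le_left _ _) (min_le_right _ _) ?_ hx hy
  · have hk₁ := hκ.trans_le h₁
    have hk₂ := hκ.trans_le h₂
    have h := abs_prufer_sub_le (q := q) hκ h₁ h₂ hq0 hNpos hN hV0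
      (fun m x hx => (hVn m x hx).trans_eq (by simp only [hq]; field_simp)) hVg
      (hθd k₁ hk₁) (hθd k₂ hk₂) (hθ0 k₁ hk₁) (hθ0 k₂ hk₂) j L hLj
    have h1 : deviationBound κ q N (j + 1) ≤ δ * L :=
      ((div_lt_iff₀ (hNpos j)).1 (hn₀ j hj)).le.trans (by gcongr; exact hLj.1)
    calc _ ≤ |k₂ - k₁| * deviationBound κ q N (j + 1) := h
      _ ≤ |k₂ - k₁| * (δ * L) := by gcongr
      _ = _ := mul_comm _ _
  · exact hθz k (hκ.trans_le hk) L hL0.le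
  · rw [hκdef]
    linarith [Real.sqrt_le_sqrt (mem_Ici.1 hξs)]
  · have h1 : 2 * ((|(n : ℝ)| + 2) * π) / (κ * η) < L := by
      linarith [(le_max_right _ _).trans hL]
    rw [div_lt_iff₀ (by positivity)] at h1
    linarith

end Pearson

theorem not_summable_inv_sqrt_sq :
    ¬ Summable fun n : ℕ => (1 / √((n : ℝ) + 1)) ^ 2 := by
  have h : (fun n : ℕ => (1 / √((n : ℝ) + 1)) ^ 2) = fun n : ℕ => 1 / (((n + 1 : ℕ) : ℝ)) := by
    funext n
    rw [div_pow, Real.sq_sqrt (by positivity)]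
    simp
  rw [h, summable_nat_add_iff (f := fun n : ℕ => 1 / (n : ℝ)) 1]
  exact Real.not_summable_one_div_natCast

theorem tendsto_inv_sqrt : Tendsto (fun n : ℕ => 1 / √((n : ℝ) + 1)) atTop (𝓝 0) := by
  have h : Tendsto (fun n : ℕ => √(1 / ((n : ℝ) + 1))) atTop (𝓝 0) := by
    simpa [Function.comp_def] using
      (Real.continuous_sqrt.tendsto 0).comp (tendsto_one_div_add_atTop_nhds_zero_nat (𝕜 := ℝ))
  simpa using h

/-- The uniform clock theorem with `W` not identically zero, so that the potential is genuinely
a Pearson potential. -/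
theorem exists_pearson_uniform_clock :
    ∃ (W : ℝ → ℝ) (lam : ℕ → ℝ) (N : ℕ → ℝ), W ≠ 0 ∧
      ContDiff ℝ (⊤ : ℕ∞) W ∧ (∀ x, 0 ≤ W x) ∧ Function.support W ⊆ Icc 0 1 ∧
      Tendsto lam atTop (𝓝 0) ∧ ¬ Summable (fun n => lam n ^ 2) ∧
      (∀ n, 0 < N n) ∧ StrictMono N ∧ (∀ n, N n + 1 < N (n + 1)) ∧
      Tendsto (fun n => N n / N (n + 1)) atTop (𝓝 0) ∧
      ∀ u ux : ℝ → ℝ → ℝ,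
        (∀ ξ : ℝ, ∀ x ∈ Ici (0 : ℝ), HasDerivWithinAt (u ξ) (ux ξ x) (Ici 0) x) →
        (∀ ξ : ℝ, ∀ x ∈ Ici (0 : ℝ),
          HasDerivWithinAt (ux ξ) (((∑' n, lam n * W (x - N n)) - ξ) * u ξ x) (Ici 0) x) →
        (∀ ξ : ℝ, u ξ 0 = 1) → (∀ ξ : ℝ, ux ξ 0 = 0) →
        ∀ a : ℝ, 0 < a → ∀ n : ℤ, ∀ ε : ℝ, 0 < ε →
          ∃ L₀ : ℝ, ∀ L : ℝ, L₀ ≤ L → ∀ ξs ∈ Ici a, ∀ x y : ℝ,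
            IsNthPoint {ξ : ℝ | ux ξ L = 0} ξs n x →
            IsNthPoint {ξ : ℝ | ux ξ L = 0} ξs (n + 1) y →
            |L * (y - x) * (1 / (2 * π * √ξs)) - 1| < ε := by
  let W : ContDiffBump (1 / 2 : ℝ) := ⟨1 / 4, 1 / 2, by norm_num, by norm_num⟩
  have hsupp : Function.support W ⊆ Icc 0 1 := by
    rw [W.support_eq, Real.ball_eq_Ioo]
    refine Ioo_subset_Icc_self.trans (Icc_subset_Icc ?_ ?_) <;> norm_num [W]
  have hfact : ∀ n : ℕ, (1 : ℝ) ≤ ((n + 1).factorial : ℝ) := fun n => by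
    exact_mod_cast Nat.one_le_iff_ne_zero.2 (Nat.factorial_ne_zero _)
  have hsucc : ∀ n : ℕ, ((n + 1 + 1).factorial : ℝ) = (n + 2) * (n + 1).factorial := fun n => by
    rw [Nat.factorial_succ (n + 1)]
    push_cast
    ring
  have hgap : ∀ n : ℕ, 2 * ((n + 1).factorial : ℝ) + 1 < 2 * ((n + 1 + 1).factorial : ℝ) := by
    intro n
    rw [hsucc n]
    nlinarith [hfact n, mul_nonneg (Nat.cast_nonneg (α := ℝ) n) (zero_le_one.trans (hfact n))]
  have hratio : Tendsto (fun n : ℕ => 2 * ((n + 1).factorial : ℝ) /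
      (2 * ((n + 1 + 1).factorial : ℝ))) atTop (𝓝 0) := by
    have h : (fun n : ℕ => 2 * ((n + 1).factorial : ℝ) / (2 * ((n + 1 + 1).factorial : ℝ))) =
        fun n : ℕ => 1 / (((n + 1 : ℕ) : ℝ) + 1) := by
      funext n
      have := hfact n
      rw [hsucc n]
      push_cast
      field_simp
      ring
    rw [h]
    exact (tendsto_one_div_add_atTop_nhds_zero_nat (𝕜 := ℝ)).comp (tendsto_add_atTop_nat 1)
  have hpos : ∀ n : ℕ, 0 < 2 * ((n + 1).factorial : ℝ) := fun n => by linarith [hfact n]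
  refine ⟨W, fun n => 1 / √((n : ℝ) + 1), fun n => 2 * ((n + 1).factorial : ℝ), fun h => ?_,
    W.contDiff, fun x => W.nonneg, hsupp, tendsto_inv_sqrt, not_summable_inv_sqrt_sq, hpos,
    strictMono_nat_of_lt_succ fun n => by linarith [hgap n], hgap, hratio, ?_⟩
  · have h1 : W (1 / 2) = 1 :=
      W.one_of_mem_closedBall (Metric.mem_closedBall_self W.rIn_pos.le)
    rw [h] at h1
    exact zero_ne_one h1
  · intro u ux hu hux hu0 hux0 a ha n ε hε
    exact pearson_uniform_clock W.continuous hsupp tendsto_inv_sqrt hpos hgap hratio u ux hu hux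
      hu0 hux0 ha n hε

/-- There exist a smooth nonnegative `W` supported in `[0,1]`, amplitudes `λₙ → 0` with
`Σ λₙ² = ∞` (hence purely singular continuous spectrum on `(0,∞)` by Kiselev–Last–Simon),
and a sparse sequence `Nₙ`, such that the Pearson potential `V(x) = Σₙ λₙ W(x − Nₙ)`
exhibits uniform clock behavior with `ρ(ξ) = 1/(2π√ξ)` on every compact interval of
`(0,∞)`. -/
theorem exists_singular_continuous_with_clock_behavior :
    ∃ (W : ℝ → ℝ) (lam : ℕ → ℝ) (N : ℕ → ℝ),
      ContDiff ℝ (⊤ : ℕ∞) W ∧ (∀ x, 0 ≤ W x) ∧ Function.support W ⊆ Set.Icc 0 1 ∧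
      Filter.Tendsto lam Filter.atTop (nhds 0) ∧ ¬ Summable (fun n => lam n ^ 2) ∧
      (∀ n, 0 < N n) ∧ StrictMono N ∧ (∀ n, N n + 1 < N (n + 1)) ∧
      Filter.Tendsto (fun n => N n / N (n + 1)) Filter.atTop (nhds 0) ∧
      ∀ u ux : ℝ → ℝ → ℝ,
        (∀ ξ : ℝ, ∀ x ∈ Set.Ici (0 : ℝ), HasDerivWithinAt (u ξ) (ux ξ x) (Set.Ici 0) x) →
        (∀ ξ : ℝ, ∀ x ∈ Set.Ici (0 : ℝ),
          HasDerivWithinAt (ux ξ)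
            (((∑' n, lam n * W (x - N n)) - ξ) * u ξ x) (Set.Ici 0) x) →
        (∀ ξ : ℝ, u ξ 0 = 1) → (∀ ξ : ℝ, ux ξ 0 = 0) →
        ∀ a b : ℝ, 0 < a → a ≤ b → ∀ n : ℤ, ∀ ε : ℝ, 0 < ε →
          ∃ L₀ : ℝ, ∀ L : ℝ, L₀ ≤ L → ∀ ξs ∈ Set.Icc a b, ∀ x y : ℝ,
            IsNthPoint {ξ : ℝ | ux ξ L = 0} ξs n x →
            IsNthPoint {ξ : ℝ | ux ξ L = 0} ξs (n + 1) y →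
            |L * (y - x) * (1 / (2 * π * Real.sqrt ξs)) - 1| < ε := by
  obtain ⟨W, lam, N, -, hW, hW0, hWs, hlam, hsum, hN0, hNm, hN, hNr, h⟩ :=
    exists_pearson_uniform_clock
  refine ⟨W, lam, N, hW, hW0, hWs, hlam, hsum, hN0, hNm, hN, hNr,
    fun u ux hu hux hu0 hux0 a b ha _ n ε hε => ?_⟩
  obtain ⟨L₀, hL₀⟩ := h u ux hu hux hu0 hux0 a ha n ε hε
  exact ⟨L₀, fun L hL ξs hξs => hL₀ L hL ξs hξs.1⟩
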